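/- Let W be a subspace of ℝ⁵. Then the following are equivalent: (i) W is 2-dimensional, W ∩ V₀ = {0}, and Ω(u,v) = (0,0) for all u, v ∈ W; (ii) there exists p ∈ ℝ⁴ with W = L(p). Moreover, such a p is unique: L(p) = L(q) implies p = q. -/

import Mathlib

/-- The Lagrangian plane `L(p) ⊆ ℝ⁵` for `p = (p₁₁₁,p₁₁₂,p₁₂₂,p₂₂₂) ∈ ℝ⁴`. -/
def lagPlane (p : Fin 4 → ℝ) : Submodule ℝ (Fin 5 → ℝ) :=
  Submodule.span ℝ {![1, 0, p 0, p 1, p 2], ![0, 1, p 1, p 2, p 3]}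

/-- The vertical subspace `V₀ = {v ∈ ℝ⁵ : v₁ = v₂ = 0}`. -/
def vertical : Submodule ℝ (Fin 5 → ℝ) :=
  LinearMap.ker (LinearMap.proj (R := ℝ) (φ := fun _ : Fin 5 => ℝ) 0) ⊓
    LinearMap.ker (LinearMap.proj (R := ℝ) (φ := fun _ : Fin 5 => ℝ) 1)

/-- Coordinate expression of the meta-symplectic form `Ω` on ℝ⁵, with values in ℝ². -/
def metaOmega (u v : Fin 5 → ℝ) : Fin 2 → ℝ :=
  ![u 2 * v 0 - v 2 * u 0 + u 3 * v 1 - v 3 * u 1,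
    u 3 * v 0 - v 3 * u 0 + u 4 * v 1 - v 4 * u 1]

/-- `L(p)` is the graph of the linear map with coefficients `p` over the horizontal coordinates. -/
theorem mem_lagPlane {p : Fin 4 → ℝ} {v : Fin 5 → ℝ} :
    v ∈ lagPlane p ↔ v 2 = v 0 * p 0 + v 1 * p 1 ∧ v 3 = v 0 * p 1 + v 1 * p 2 ∧
      v 4 = v 0 * p 2 + v 1 * p 3 := by
  rw [lagPlane, Submodule.mem_span_pair]
  constructor
  · rintro ⟨a, b, rfl⟩
    simp
  · rintro ⟨h2, h3, h4⟩
    refine ⟨v 0, v 1, ?_⟩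
    ext i
    fin_cases i <;> simp [h2, h3, h4]

theorem mem_vertical {v : Fin 5 → ℝ} : v ∈ vertical ↔ v 0 = 0 ∧ v 1 = 0 := by
  simp [vertical]

theorem metaOmega_eq_zero_iff {u v : Fin 5 → ℝ} :
    metaOmega u v = 0 ↔ u 2 * v 0 - v 2 * u 0 + u 3 * v 1 - v 3 * u 1 = 0 ∧
      u 3 * v 0 - v 3 * u 0 + u 4 * v 1 - v 4 * u 1 = 0 := by
  simp [metaOmega]

theorem lagPlane_injective : Function.Injective lagPlane := by
  intro p q h
  have h₁ : ![1, 0, p 0, p 1, p 2] ∈ lagPlane q := h ▸ Submodule.subset_span (by simp)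
  have h₂ : ![0, 1, p 1, p 2, p 3] ∈ lagPlane q := h ▸ Submodule.subset_span (by simp)
  simp only [mem_lagPlane] at h₁ h₂
  ext i
  fin_cases i <;> simp_all

theorem finrank_lagPlane (p : Fin 4 → ℝ) : Module.finrank ℝ (lagPlane p) = 2 := by
  have hli : LinearIndependent ℝ
      ![(![1, 0, p 0, p 1, p 2] : Fin 5 → ℝ), ![0, 1, p 1, p 2, p 3]] := by
    rw [LinearIndependent.pair_iff]
    intro a b h
    exact ⟨by simpa using congrFun h 0, by simpa using congrFun h 1⟩
  have h := finrank_span_eq_card hli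
  rwa [Matrix.range_cons_cons_empty, Fintype.card_fin] at h

theorem lagPlane_inf_vertical (p : Fin 4 → ℝ) : lagPlane p ⊓ vertical = ⊥ := by
  rw [Submodule.eq_bot_iff]
  rintro v ⟨hL, hV⟩
  obtain ⟨h2, h3, h4⟩ := mem_lagPlane.1 hL
  obtain ⟨h0, h1⟩ := mem_vertical.1 hV
  ext i
  fin_cases i <;> simp [h0, h1, h2, h3, h4]

theorem metaOmega_eq_zero_of_mem_lagPlane {p : Fin 4 → ℝ} {u v : Fin 5 → ℝ}
    (hu : u ∈ lagPlane p) (hv : v ∈ lagPlane p) : metaOmega u v = 0 := by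
  obtain ⟨hu2, hu3, hu4⟩ := mem_lagPlane.1 hu
  obtain ⟨hv2, hv3, hv4⟩ := mem_lagPlane.1 hv
  rw [metaOmega_eq_zero_iff, hu2, hu3, hu4, hv2, hv3, hv4]
  constructor <;> ring

/-- A horizontal plane contains a vector with any prescribed horizontal coordinates. -/
theorem exists_mem_of_horizontal {W : Submodule ℝ (Fin 5 → ℝ)}
    (hdim : Module.finrank ℝ W = 2) (hW : W ⊓ vertical = ⊥) (a b : ℝ) :
    ∃ v ∈ W, v 0 = a ∧ v 1 = b := by
  let π : W →ₗ[ℝ] ℝ × ℝ :=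
    ((LinearMap.proj 0).prod (LinearMap.proj 1) : (Fin 5 → ℝ) →ₗ[ℝ] ℝ × ℝ).comp W.subtype
  have hinj : Function.Injective π := by
    rw [injective_iff_map_eq_zero]
    rintro ⟨v, hv⟩ h
    have hV : v ∈ vertical := mem_vertical.2 (Prod.mk.inj h)
    have hbot : v ∈ W ⊓ vertical := ⟨hv, hV⟩
    rw [hW, Submodule.mem_bot] at hbot
    exact Subtype.ext hbot
  have hsurj : Function.Surjective π :=
    (LinearMap.injective_iff_surjective_of_finrank_eq_finrank (by simp [hdim])).1 hinj
  obtain ⟨⟨v, hv⟩, h⟩ := hsurj (a, b)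
  exact ⟨v, hv, Prod.mk.inj h⟩

theorem exists_eq_lagPlane {W : Submodule ℝ (Fin 5 → ℝ)}
    (hdim : Module.finrank ℝ W = 2) (hW : W ⊓ vertical = ⊥)
    (hΩ : ∀ u ∈ W, ∀ v ∈ W, metaOmega u v = 0) : ∃ p : Fin 4 → ℝ, W = lagPlane p := by
  obtain ⟨u, hu, hu0, hu1⟩ := exists_mem_of_horizontal hdim hW 1 0
  obtain ⟨v, hv, hv0, hv1⟩ := exists_mem_of_horizontal hdim hW 0 1
  obtain ⟨h₁, h₂⟩ := metaOmega_eq_zero_iff.1 (hΩ u hu v hv)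
  simp only [hu0, hu1, hv0, hv1] at h₁ h₂
  have h32 : v 2 = u 3 := by linarith
  have h43 : v 3 = u 4 := by linarith
  refine ⟨![u 2, u 3, u 4, v 4], (Submodule.eq_of_le_of_finrank_eq ?_ ?_).symm⟩
  · rw [lagPlane, Submodule.span_le, Set.insert_subset_iff, Set.singleton_subset_iff]
    constructor
    · rw [SetLike.mem_coe]
      convert hu using 2
      ext i
      fin_cases i <;> simp [hu0, hu1]
    · rw [SetLike.mem_coe]
      convert hv using 2
      ext i
      fin_cases i <;> simp [hv0, hv1, h32, h43]
  · rw [finrank_lagPlane, hdim]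

/-- The fibre of the second prolongation: the horizontal `Ω`-isotropic 2-planes of
the prolonged contact distribution are exactly the Lagrangian planes `L(p)`, and
`p` is uniquely determined. -/
theorem horizontal_isotropic_iff_lagPlane (W : Submodule ℝ (Fin 5 → ℝ)) :
    ((Module.finrank ℝ W = 2 ∧ W ⊓ vertical = ⊥ ∧
        ∀ u ∈ W, ∀ v ∈ W, metaOmega u v = 0) ↔
      ∃ p : Fin 4 → ℝ, W = lagPlane p) ∧
    ∀ p q : Fin 4 → ℝ, lagPlane p = lagPlane q → p = q := by
  refine ⟨⟨fun ⟨hdim, hW, hΩ⟩ => exists_eq_lagPlane hdim hW hΩ, ?_⟩,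
    fun _ _ h => lagPlane_injective h⟩
  rintro ⟨p, rfl⟩
  exact ⟨finrank_lagPlane p, lagPlane_inf_vertical p,
    fun _ hu _ hv => metaOmega_eq_zero_of_mem_lagPlane hu hv⟩
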